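/- The set {x^A : A ∈ M_n(ℤ≥0)} of lexicographically ordered monomials is a basis of O_q(M(n)) as a vector space over K = ℚ(q). -/

import Mathlib

open scoped TensorProduct

set_option synthInstance.maxHeartbeats 1000000
set_option maxHeartbeats 1000000

noncomputable section

/-- The base field `K = ℚ(q)`. -/
abbrev Kq : Type := RatFunc ℚ

/-- The indeterminate `q ∈ ℚ(q)`. -/
noncomputable def qq : Kq := RatFunc.X

/-- Matrices with nonnegative integer entries. -/
abbrev Mat (n : ℕ) := Matrix (Fin n) (Fin n) ℕ

/-- The defining relations of the quantum matrix algebra `O_q(M(n))`. -/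
inductive OqRel (n : ℕ) :
    FreeAlgebra Kq (Fin n × Fin n) → FreeAlgebra Kq (Fin n × Fin n) → Prop
  | rel_row {i j k : Fin n} (h : j < k) :
      OqRel n (FreeAlgebra.ι Kq (i, j) * FreeAlgebra.ι Kq (i, k))
        ((qq ^ 2) • (FreeAlgebra.ι Kq (i, k) * FreeAlgebra.ι Kq (i, j)))
  | rel_col {i k j : Fin n} (h : i < k) :
      OqRel n (FreeAlgebra.ι Kq (i, j) * FreeAlgebra.ι Kq (k, j))
        ((qq ^ 2) • (FreeAlgebra.ι Kq (k, j) * FreeAlgebra.ι Kq (i, j)))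
  | rel_anti {i j s t : Fin n} (h1 : s < i) (h2 : j < t) :
      OqRel n (FreeAlgebra.ι Kq (i, j) * FreeAlgebra.ι Kq (s, t))
        (FreeAlgebra.ι Kq (s, t) * FreeAlgebra.ι Kq (i, j))
  | rel_diag {i j s t : Fin n} (h1 : i < s) (h2 : j < t) :
      OqRel n (FreeAlgebra.ι Kq (i, j) * FreeAlgebra.ι Kq (s, t))
        (FreeAlgebra.ι Kq (s, t) * FreeAlgebra.ι Kq (i, j)
          + (qq ^ 2 - qq⁻¹ ^ 2) • (FreeAlgebra.ι Kq (i, t) * FreeAlgebra.ι Kq (s, j)))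

/-- The quantum matrix algebra `O_q(M(n))`. -/
abbrev Oq (n : ℕ) := RingQuot (OqRel n)

/-- The generator `x_{ij}` of `O_q(M(n))`. -/
noncomputable def xgen (n : ℕ) (i j : Fin n) : Oq n :=
  RingQuot.mkAlgHom Kq (OqRel n) (FreeAlgebra.ι Kq (i, j))

/-- The lexicographically ordered monomial `x^A`. -/
noncomputable def xMon (n : ℕ) (A : Mat n) : Oq n :=
  ((List.finRange n).map fun i =>
    ((List.finRange n).map fun j => xgen n i j ^ A i j).prod).prod

theorem qq_ne_zero : qq ≠ 0 := RatFunc.X_ne_zero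

section QuantumMatrices

variable {n : ℕ} {S : Type*} [Ring S] [Algebra Kq S]

/-- A matrix whose entries satisfy the defining relations of `O_q(M(n))`. -/
structure IsQuantum (M : Matrix (Fin n) (Fin n) S) : Prop where
  row : ∀ {i j k}, j < k → M i j * M i k = (qq ^ 2) • (M i k * M i j)
  col : ∀ {i k j}, i < k → M i j * M k j = (qq ^ 2) • (M k j * M i j)
  anti : ∀ {i j s t}, s < i → j < t → M i j * M s t = M s t * M i j
  diag : ∀ {i j s t}, i < s → j < t →
    M i j * M s t = M s t * M i j + (qq ^ 2 - qq⁻¹ ^ 2) • (M i t * M s j)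

/-- The diagonal part of the R-matrix. -/
def rDiag (i j : Fin n) : Kq := if i = j then qq ^ 2 else 1

/-- The off-diagonal part of the R-matrix. -/
def rOff (i j : Fin n) : Kq := if j < i then qq ^ 2 - qq⁻¹ ^ 2 else 0

/-- The entries of the identity `R M₁ M₂ = M₂ M₁ R`. -/
def SatisfiesRTT (M : Matrix (Fin n) (Fin n) S) : Prop :=
  ∀ i j k l, rDiag i j • (M i k * M j l) + rOff i j • (M j k * M i l)
    = rDiag k l • (M j l * M i k) + rOff l k • (M j k * M i l)

theorem IsQuantum.satisfiesRTT {M : Matrix (Fin n) (Fin n) S} (hM : IsQuantum M) :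
    SatisfiesRTT M := by
  have hq : qq ^ 2 ≠ 0 := pow_ne_zero 2 qq_ne_zero
  have hone : (qq ^ 2 - qq⁻¹ ^ 2) * qq ^ 2 + 1 = qq ^ 2 * qq ^ 2 := by
    field_simp [qq_ne_zero]
    ring
  intro i j k l
  rcases lt_trichotomy i j with hij | rfl | hij <;> rcases lt_trichotomy k l with hkl | rfl | hkl
  · simp [rDiag, rOff, hij.ne, hkl.ne, hij.not_gt, hkl, hM.diag hij hkl, hM.anti hij hkl]
  · simp [rDiag, rOff, hij.ne, hij.not_gt, hM.col hij]
  · simp [rDiag, rOff, hij.ne, hkl.ne', hij.not_gt, hkl.not_gt, hM.anti hij hkl]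
  · simp only [rDiag, rOff, hkl.ne, hkl, lt_irrefl, if_true, if_false, one_smul, hM.row hkl]
    rw [zero_smul, add_zero, smul_smul, smul_smul, ← hone, add_smul, one_smul, add_comm]
  · simp [rDiag, rOff]
  · simp [rDiag, rOff, hkl.ne', hkl.not_gt, hM.row hkl]
  · simp only [rDiag, rOff, hij.ne', hkl.ne, hkl, hij, if_true, if_false, one_smul,
      hM.anti hij hkl]
  · simp only [rDiag, rOff, hij.ne', hij, lt_irrefl, if_true, if_false, one_smul, hM.col hij]
    rw [zero_smul, add_zero, smul_smul, smul_smul, ← hone, add_smul, one_smul, add_comm]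
  · simp only [rDiag, rOff, hij.ne', hkl.ne', hkl.not_gt, hij, if_true, if_false, one_smul,
      zero_smul, add_zero, hM.diag hij hkl]

theorem SatisfiesRTT.isQuantum {M : Matrix (Fin n) (Fin n) S} (hM : SatisfiesRTT M) :
    IsQuantum M where
  row {i j k} h := by
    have := hM i i k j
    simp only [rDiag, rOff, h.ne', h.not_gt, lt_irrefl, if_true, if_false, zero_smul, add_zero,
      one_smul] at this
    exact this.symm
  col {i k j} h := by
    have := hM i k j j
    simpa only [rDiag, rOff, h.ne, h.not_gt, lt_irrefl, if_true, if_false, zero_smul, add_zero,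
      one_smul] using this
  anti {i j s t} h1 h2 := by
    have := hM s i t j
    simp only [rDiag, rOff, h1.ne, h1.not_gt, h2.ne', h2.not_gt, if_false, zero_smul, add_zero,
      one_smul] at this
    exact this.symm
  diag {i j s t} h1 h2 := by
    have := hM i s j t
    have h3 := hM i s t j
    simp only [rDiag, rOff, h1.ne, h1.not_gt, h2.ne', h2.not_gt, if_false, zero_smul, add_zero,
      one_smul] at h3
    simpa only [rDiag, rOff, h1.ne, h1.not_gt, h2.ne, h2, if_true, if_false, zero_smul, add_zero,
      one_smul, h3] using this

theorem SatisfiesRTT.mul {M N : Matrix (Fin n) (Fin n) S} (hM : SatisfiesRTT M)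
    (hN : SatisfiesRTT N) (h : ∀ i j k l, Commute (M i j) (N k l)) : SatisfiesRTT (M * N) := by
  have hprod (i j k l : Fin n) : (M * N) i k * (M * N) j l
      = ∑ p, ∑ s, (M i p * M j s) * (N p k * N s l) := by
    simp only [Matrix.mul_apply, Finset.sum_mul_sum]
    refine Finset.sum_congr rfl fun p _ => Finset.sum_congr rfl fun s _ => ?_
    rw [mul_assoc, ← mul_assoc (N p k), ← (h j s p k).eq]
    simp only [mul_assoc]
  intro i j k l
  calc _ = ∑ p, ∑ s, (rDiag i j • (M i p * M j s) + rOff i j • (M j p * M i s))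
          * (N p k * N s l) := by
        simp only [hprod, Finset.smul_sum, ← Finset.sum_add_distrib, add_mul, smul_mul_assoc]
    _ = ∑ p, ∑ s, ((M j s * M i p) * (rDiag p s • (N p k * N s l))
          + (M j p * M i s) * (rOff s p • (N p k * N s l))) := by
        refine Finset.sum_congr rfl fun p _ => Finset.sum_congr rfl fun s _ => ?_
        rw [hM i j p s, add_mul, smul_mul_assoc, smul_mul_assoc, mul_smul_comm, mul_smul_comm]
    _ = ∑ p, ∑ s, (M j p * M i s) * (rDiag s p • (N s k * N p l) + rOff s p • (N p k * N s l)) := by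
        simp only [mul_add, Finset.sum_add_distrib]
        congr 1
        exact Finset.sum_comm
    _ = _ := by
        simp only [hN _ _ k l, hprod, Finset.smul_sum, ← Finset.sum_add_distrib, mul_add,
          mul_smul_comm]

theorem IsQuantum.mul {M N : Matrix (Fin n) (Fin n) S} (hM : IsQuantum M) (hN : IsQuantum N)
    (h : ∀ i j k l, Commute (M i j) (N k l)) : IsQuantum (M * N) :=
  (hM.satisfiesRTT.mul hN.satisfiesRTT h).isQuantum

theorem IsQuantum.transpose {M : Matrix (Fin n) (Fin n) S} (hM : IsQuantum M) :
    IsQuantum M.transpose where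
  row h := hM.col h
  col h := hM.row h
  anti h1 h2 := (hM.anti h2 h1).symm
  diag h1 h2 := by
    simp only [Matrix.transpose_apply]
    rw [hM.diag h2 h1, hM.anti h2 h1]

theorem isQuantum_diagonal {d : Fin n → S} (hd : ∀ i j, Commute (d i) (d j)) :
    IsQuantum (Matrix.diagonal d) where
  row {i j k} h := by
    rcases eq_or_ne i j with rfl | hi
    · simp [Matrix.diagonal_apply_ne _ h.ne]
    · simp [Matrix.diagonal_apply_ne _ hi]
  col {i k j} h := by
    rcases eq_or_ne i j with rfl | hi
    · simp [Matrix.diagonal_apply_ne _ h.ne']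
    · simp [Matrix.diagonal_apply_ne _ hi]
  anti {i j s t} h1 h2 := by
    simp only [Matrix.diagonal_apply]
    split_ifs <;> simp [(hd _ _).eq]
  diag {i j s t} h1 h2 := by
    have : Matrix.diagonal d i t * Matrix.diagonal d s j = 0 := by
      simp only [Matrix.diagonal_apply]
      split_ifs with h3 h4
      · omega
      all_goals simp
    rw [this, smul_zero, add_zero]
    simp only [Matrix.diagonal_apply]
    split_ifs <;> simp [(hd _ _).eq]

/-- The lower bidiagonal matrix with diagonal entries `a i` and entries `c i` at
position `(i, i - 1)`. -/
def bidiagonal (n : ℕ) (a c : ℕ → S) : Matrix (Fin n) (Fin n) S := fun i j =>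
  if (i : ℕ) = j then a i else if (i : ℕ) = j + 1 then c i else 0

theorem isQuantum_bidiagonal {a c : ℕ → S} (haa : ∀ i j, Commute (a i) (a j))
    (hcc : ∀ i j, Commute (c i) (c j))
    (hac : ∀ i j, j ≠ i → j ≠ i + 1 → Commute (a i) (c j))
    (hcol : ∀ i, a i * c (i + 1) = qq ^ 2 • (c (i + 1) * a i))
    (hrow : ∀ i, c i * a i = qq ^ 2 • (a i * c i)) : IsQuantum (bidiagonal n a c) where
  row {i j k} h := by
    have h' : (j : ℕ) < k := h
    simp only [bidiagonal]
    split_ifs <;> first | omega | simp [hrow]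
  col {i k j} h := by
    have h' : (i : ℕ) < k := h
    simp only [bidiagonal]
    split_ifs with h1 h2 h3 h4 <;> first
      | omega
      | simp
      | (rw [h3, ← h1, hcol])
  anti {i j s t} h1 h2 := by
    have h1' : (s : ℕ) < i := h1
    have h2' : (j : ℕ) < t := h2
    simp only [bidiagonal]
    split_ifs <;> first | omega | simp
  diag {i j s t} h1 h2 := by
    have h1' : (i : ℕ) < s := h1
    have h2' : (j : ℕ) < t := h2
    have : bidiagonal n a c i t * bidiagonal n a c s j = 0 := by
      simp only [bidiagonal]
      split_ifs <;> first | omega | simp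
    rw [this, smul_zero, add_zero]
    simp only [bidiagonal]
    split_ifs <;> first
      | exact haa _ _
      | exact hcc _ _
      | exact hac _ _ (by omega) (by omega)
      | exact (hac _ _ (by omega) (by omega)).symm
      | simp

/-- The algebra map from `O_q(M(n))` determined by a quantum matrix. -/
def IsQuantum.lift {M : Matrix (Fin n) (Fin n) S} (hM : IsQuantum M) : Oq n →ₐ[Kq] S :=
  RingQuot.liftAlgHom Kq ⟨FreeAlgebra.lift Kq fun p => M p.1 p.2, fun {x y} h => by
    induction h with
    | rel_row h => simpa using hM.row h
    | rel_col h => simpa using hM.col h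
    | rel_anti h1 h2 => simpa using hM.anti h1 h2
    | rel_diag h1 h2 => simpa using hM.diag h1 h2⟩

theorem IsQuantum.lift_xgen {M : Matrix (Fin n) (Fin n) S} (hM : IsQuantum M) (i j : Fin n) :
    hM.lift (xgen n i j) = M i j := by
  simp [IsQuantum.lift, xgen]

/-- The lexicographic order on positions. -/
def LexLE (p p' : Fin n × Fin n) : Prop := toLex p ≤ toLex p'

/-- A product of two generators in decreasing lexicographic order is a combination of the
increasing product and of a product whose first factor is smaller. -/
theorem IsQuantum.straighten {M : Matrix (Fin n) (Fin n) S} (hM : IsQuantum M)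
    {p p' : Fin n × Fin n} (h : toLex p < toLex p') :
    ∃ (c d : Kq) (a b : Fin n × Fin n), toLex a < toLex p' ∧
      M p'.1 p'.2 * M p.1 p.2
        = c • (M p.1 p.2 * M p'.1 p'.2) + d • (M a.1 a.2 * M b.1 b.2) := by
  obtain ⟨i, j⟩ := p
  obtain ⟨s, t⟩ := p'
  have hq : qq ^ 2 ≠ 0 := pow_ne_zero 2 qq_ne_zero
  rcases (Prod.Lex.toLex_lt_toLex).1 h with h1 | ⟨h1, h2⟩
  · dsimp only at h1
    rcases lt_trichotomy j t with h2 | rfl | h2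
    · refine ⟨1, -(qq ^ 2 - qq⁻¹ ^ 2), (i, t), (s, j),
        (Prod.Lex.toLex_lt_toLex).2 (Or.inl h1), ?_⟩
      rw [hM.diag h1 h2, one_smul, neg_smul, add_neg_cancel_right]
    · refine ⟨(qq ^ 2)⁻¹, 0, (i, j), (i, j), h, ?_⟩
      rw [hM.col h1, inv_smul_smul₀ hq, zero_smul, add_zero]
    · refine ⟨1, 0, (i, j), (i, j), h, ?_⟩
      rw [hM.anti h1 h2, one_smul, zero_smul, add_zero]
  · dsimp only at h1 h2
    subst h1
    refine ⟨(qq ^ 2)⁻¹, 0, (i, j), (i, j), h, ?_⟩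
    rw [hM.row h2, inv_smul_smul₀ hq, zero_smul, add_zero]

/-- The product of generators along a word. -/
def wordProd (M : Matrix (Fin n) (Fin n) S) (l : List (Fin n × Fin n)) : S :=
  (l.map fun p => M p.1 p.2).prod

omit [Algebra Kq S] in
theorem wordProd_cons (M : Matrix (Fin n) (Fin n) S) (p : Fin n × Fin n)
    (l : List (Fin n × Fin n)) :
    wordProd M (p :: l) = M p.1 p.2 * wordProd M l := by
  simp [wordProd]

/-- The span of the lexicographically ordered words of length `r`. -/
def orderedSpan (M : Matrix (Fin n) (Fin n) S) (r : ℕ) : Submodule Kq S :=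
  Submodule.span Kq (wordProd M '' {l | l.length = r ∧ l.Pairwise LexLE})

theorem wordProd_mem_orderedSpan (M : Matrix (Fin n) (Fin n) S) {r : ℕ}
    {l : List (Fin n × Fin n)} (hr : l.length = r) (hl : l.Pairwise LexLE) :
    wordProd M l ∈ orderedSpan M r :=
  Submodule.subset_span ⟨l, ⟨hr, hl⟩, rfl⟩

theorem mul_mem_of_forall {M : Matrix (Fin n) (Fin n) S} {r s : ℕ} {p : Fin n × Fin n}
    (h : ∀ l : List (Fin n × Fin n), l.length = r → l.Pairwise LexLE →
      M p.1 p.2 * wordProd M l ∈ orderedSpan M s) {y : S} (hy : y ∈ orderedSpan M r) :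
    M p.1 p.2 * y ∈ orderedSpan M s := by
  have : orderedSpan M r ≤
      (orderedSpan M s).comap (LinearMap.mulLeft Kq (M p.1 p.2)) := by
    refine Submodule.span_le.2 ?_
    rintro _ ⟨l, ⟨hl, hs⟩, rfl⟩
    exact h l hl hs
  exact this hy

theorem IsQuantum.mul_mem_orderedSpan {M : Matrix (Fin n) (Fin n) S} (hM : IsQuantum M) (r : ℕ)
    (p : Fin n × Fin n) {y : S}
    (hy : y ∈ orderedSpan M r) : M p.1 p.2 * y ∈ orderedSpan M (r + 1) := by
  induction r generalizing p y with
  | zero =>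
    refine mul_mem_of_forall (fun l hl _ => ?_) hy
    obtain rfl := List.length_eq_zero_iff.1 hl
    rw [← wordProd_cons M]
    exact wordProd_mem_orderedSpan M rfl (List.pairwise_singleton _ _)
  | succ r ihr =>
    have key : ∀ p : Lex (Fin n × Fin n), ∀ y ∈ orderedSpan M (r + 1),
        M (ofLex p).1 (ofLex p).2 * y ∈ orderedSpan M (r + 2) := by
      intro p
      induction p using WellFoundedLT.induction with
      | ind p ihp =>
      intro y hy
      refine mul_mem_of_forall (fun l hl hs => ?_) hy
      cases l with
      | nil => simp at hl
      | cons p₂ l =>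
        have hlen : l.length = r := by simpa using hl
        by_cases hp : p ≤ toLex p₂
        · rw [← wordProd_cons M]
          refine wordProd_mem_orderedSpan M (by simp [hlen])
            (List.pairwise_cons.2 ⟨fun x hx => ?_, hs⟩)
          rcases List.mem_cons.1 hx with rfl | hx
          · exact hp
          · exact le_trans hp ((List.pairwise_cons.1 hs).1 x hx)
        · obtain ⟨c, d, a, b, ha, he⟩ := hM.straighten (p := p₂) (p' := ofLex p) (not_le.1 hp)
          have hl' : wordProd M l ∈ orderedSpan M r :=
            wordProd_mem_orderedSpan M hlen (List.pairwise_cons.1 hs).2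
          rw [wordProd_cons, ← mul_assoc, he, add_mul, smul_mul_assoc, smul_mul_assoc, mul_assoc,
            mul_assoc]
          exact Submodule.add_mem _
            (Submodule.smul_mem _ _ (ihp (toLex p₂) (not_le.1 hp) _ (ihr _ hl')))
            (Submodule.smul_mem _ _ (ihp (toLex a) ha _ (ihr _ hl')))
    exact key (toLex p) y hy

/-- The lexicographically ordered word with prescribed multiplicities. -/
def matWord (A : Mat n) : List (Fin n × Fin n) :=
  (List.finRange n).flatMap fun i =>
    (List.finRange n).flatMap fun j => List.replicate (A i j) (i, j)

theorem prod_map_flatMap {α β M : Type*} [Monoid M] (f : β → M) (g : α → List β) (l : List α) :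
    ((l.flatMap g).map f).prod = (l.map fun a => ((g a).map f).prod).prod := by
  induction l with
  | nil => simp
  | cons a l ih => simp [ih]

/-- The lexicographically ordered monomial in the entries of a matrix. -/
def orderedMon (M : Matrix (Fin n) (Fin n) S) (A : Mat n) : S :=
  ((List.finRange n).map fun i => ((List.finRange n).map fun j => M i j ^ A i j).prod).prod

omit [Algebra Kq S] in
theorem wordProd_matWord (M : Matrix (Fin n) (Fin n) S) (A : Mat n) :
    wordProd M (matWord A) = orderedMon M A := by
  simp [wordProd, matWord, orderedMon, prod_map_flatMap]

theorem pairwise_matWord (A : Mat n) : (matWord A).Pairwise LexLE := by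
  refine List.pairwise_flatMap.2 ⟨fun i _ => List.pairwise_flatMap.2 ⟨fun j _ => ?_, ?_⟩, ?_⟩
  · exact List.pairwise_replicate.2 (Or.inr le_rfl)
  · refine (List.pairwise_lt_finRange n).imp fun {j j'} h x hx y hy => ?_
    rw [List.eq_of_mem_replicate hx, List.eq_of_mem_replicate hy]
    exact ((Prod.Lex.toLex_lt_toLex (x := (i, j)) (y := (i, j'))).2 (Or.inr ⟨rfl, h⟩)).le
  · refine (List.pairwise_lt_finRange n).imp fun {i i'} h x hx y hy => ?_
    obtain ⟨j, -, hx⟩ := List.mem_flatMap.1 hx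
    obtain ⟨j', -, hy⟩ := List.mem_flatMap.1 hy
    rw [List.eq_of_mem_replicate hx, List.eq_of_mem_replicate hy]
    exact ((Prod.Lex.toLex_lt_toLex).2 (Or.inl h)).le

theorem count_matWord (A : Mat n) (i j : Fin n) : (matWord A).count (i, j) = A i j := by
  have h : ∀ i' j', List.count (i, j) (List.replicate (A i' j') (i', j'))
      = if i' = i then if j' = j then A i j else 0 else 0 := by
    intro i' j'
    rw [List.count_replicate]
    by_cases hi : i' = i <;> by_cases hj : j' = j <;> simp [hi, hj]
  simp only [matWord, List.count_flatMap, Function.comp_def, h, ← Fin.sum_univ_def]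
  simp

omit [Algebra Kq S] in
theorem exists_orderedMon_eq_wordProd (M : Matrix (Fin n) (Fin n) S) {l : List (Fin n × Fin n)}
    (hl : l.Pairwise LexLE) : ∃ A, orderedMon M A = wordProd M l := by
  refine ⟨Matrix.of fun i j => l.count (i, j), ?_⟩
  rw [← wordProd_matWord]
  congr 1
  refine List.Perm.eq_of_pairwise (le := LexLE) (fun a b _ _ hab hba => ?_)
    (pairwise_matWord _) hl ?_
  · exact toLex.injective (le_antisymm hab hba)
  · exact List.perm_iff_count.2 fun p => count_matWord _ p.1 p.2

theorem orderedSpan_le (M : Matrix (Fin n) (Fin n) S) (r : ℕ) :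
    orderedSpan M r ≤ Submodule.span Kq (Set.range (orderedMon M)) := by
  refine Submodule.span_mono ?_
  rintro _ ⟨l, ⟨-, hl⟩, rfl⟩
  exact exists_orderedMon_eq_wordProd M hl

theorem IsQuantum.mul_mem_span {M : Matrix (Fin n) (Fin n) S} (hM : IsQuantum M)
    (p : Fin n × Fin n) {y : S} (hy : y ∈ Submodule.span Kq (Set.range (orderedMon M))) :
    M p.1 p.2 * y ∈ Submodule.span Kq (Set.range (orderedMon M)) := by
  have : Submodule.span Kq (Set.range (orderedMon M)) ≤
      (Submodule.span Kq (Set.range (orderedMon M))).comap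
        (LinearMap.mulLeft Kq (M p.1 p.2)) := by
    refine Submodule.span_le.2 ?_
    rintro _ ⟨A, rfl⟩
    refine orderedSpan_le M _ (hM.mul_mem_orderedSpan (matWord A).length p ?_)
    rw [← wordProd_matWord]
    exact wordProd_mem_orderedSpan M rfl (pairwise_matWord A)
  exact this hy

theorem IsQuantum.lift_mem_span {M : Matrix (Fin n) (Fin n) S} (hM : IsQuantum M)
    (a : FreeAlgebra Kq (Fin n × Fin n)) {y : S}
    (hy : y ∈ Submodule.span Kq (Set.range (orderedMon M))) :
    FreeAlgebra.lift Kq (fun p => M p.1 p.2) a * y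
      ∈ Submodule.span Kq (Set.range (orderedMon M)) := by
  induction a using FreeAlgebra.induction generalizing y with
  | grade0 c =>
    rw [AlgHom.commutes, ← Algebra.smul_def]
    exact Submodule.smul_mem _ _ hy
  | grade1 p =>
    rw [FreeAlgebra.lift_ι_apply]
    exact hM.mul_mem_span p hy
  | mul a b ha hb =>
    rw [map_mul, mul_assoc]
    exact ha (hb hy)
  | add a b ha hb =>
    rw [map_add, add_mul]
    exact Submodule.add_mem _ (ha hy) (hb hy)

theorem IsQuantum.span_eq_top {M : Matrix (Fin n) (Fin n) S} (hM : IsQuantum M)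
    (hsurj : Function.Surjective (FreeAlgebra.lift Kq fun p : Fin n × Fin n => M p.1 p.2)) :
    Submodule.span Kq (Set.range (orderedMon M)) = ⊤ := by
  have hone : (1 : S) ∈ Submodule.span Kq (Set.range (orderedMon M)) :=
    orderedSpan_le M 0 (wordProd_mem_orderedSpan M (l := []) rfl List.Pairwise.nil)
  refine Submodule.eq_top_iff'.2 fun x => ?_
  obtain ⟨a, rfl⟩ := hsurj x
  simpa using hM.lift_mem_span a hone

end QuantumMatrices

theorem isQuantum_xgen (n : ℕ) : IsQuantum (Matrix.of (xgen n)) where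
  row {i _ _} h := by
    simpa only [map_mul, map_smul, Matrix.of_apply, xgen] using
      RingQuot.mkAlgHom_rel Kq (OqRel.rel_row (n := n) (i := i) h)
  col {_ _ j} h := by
    simpa only [map_mul, map_smul, Matrix.of_apply, xgen] using
      RingQuot.mkAlgHom_rel Kq (OqRel.rel_col (n := n) (j := j) h)
  anti h1 h2 := by
    simpa only [map_mul, map_smul, Matrix.of_apply, xgen] using
      RingQuot.mkAlgHom_rel Kq (OqRel.rel_anti (n := n) h1 h2)
  diag h1 h2 := by
    simpa only [map_mul, map_smul, map_add, Matrix.of_apply, xgen] using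
      RingQuot.mkAlgHom_rel Kq (OqRel.rel_diag (n := n) h1 h2)

theorem span_xMon (n : ℕ) : Submodule.span Kq (Set.range (xMon n)) = ⊤ := by
  refine (isQuantum_xgen n).span_eq_top ?_
  have : FreeAlgebra.lift Kq (fun p : Fin n × Fin n => Matrix.of (xgen n) p.1 p.2)
      = RingQuot.mkAlgHom Kq (OqRel n) := by
    ext p
    simp [xgen]
  rw [this]
  exact RingQuot.mkAlgHom_surjective Kq (OqRel n)

section LeadingTerms

variable {Γ K : Type*} [AddCommMonoid Γ] [Field K] (w : Γ →+ ℕ)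

/-- The vectors all of whose components have weight at least `N`. -/
def weightGE (N : ℕ) : Submodule K (Γ →₀ K) where
  carrier := {v | ∀ m, w m < N → v m = 0}
  add_mem' hu hv m hm := by simp [hu m hm, hv m hm]
  zero_mem' _ _ := rfl
  smul_mem' c v hv m hm := by simp [hv m hm]

variable {w}

theorem weightGE_anti {M N : ℕ} (h : M ≤ N) : weightGE (K := K) w N ≤ weightGE w M :=
  fun _ hv m hm => hv m (hm.trans_le h)

theorem single_mem_weightGE {m : Γ} {N : ℕ} (h : N ≤ w m) (c : K) :
    Finsupp.single m c ∈ weightGE w N := by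
  intro m' hm'
  refine Finsupp.single_eq_of_ne ?_
  rintro rfl
  omega

variable (w) in
/-- The operator `f` raises weights by at least `N`. -/
def RaisesWeight (N : ℕ) (f : Module.End K (Γ →₀ K)) : Prop :=
  ∀ m, f (Finsupp.single m 1) ∈ weightGE w (w m + N)

variable (w) in
/-- Up to terms of higher weight, the operator `f` shifts each basis vector by `γ`, with nonzero
coefficient. -/
def HasLead (γ : Γ) (f : Module.End K (Γ →₀ K)) : Prop :=
  ∃ s : Γ → K, (∀ m, s m ≠ 0) ∧
    ∀ m, f (Finsupp.single m 1) - Finsupp.single (m + γ) (s m) ∈ weightGE w (w m + w γ + 1)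

theorem RaisesWeight.map_mem {N M : ℕ} {f : Module.End K (Γ →₀ K)} (hf : RaisesWeight w N f)
    {v : Γ →₀ K} (hv : v ∈ weightGE w M) : f v ∈ weightGE w (M + N) := by
  have h : v = v.sum fun m c => c • Finsupp.single m (1 : K) := by
    simp
  rw [h, Finsupp.sum, map_sum]
  refine Submodule.sum_mem _ fun m hm => ?_
  rw [map_smul]
  refine Submodule.smul_mem _ _ (weightGE_anti ?_ (hf m))
  have := mt (hv m) (Finsupp.mem_support_iff.1 hm)
  omega

theorem raisesWeight_zero (N : ℕ) : RaisesWeight w N (0 : Module.End K (Γ →₀ K)) :=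
  fun _ => Submodule.zero_mem _

theorem HasLead.raisesWeight {γ : Γ} {N : ℕ} {f : Module.End K (Γ →₀ K)} (hf : HasLead w γ f)
    (hN : N ≤ w γ) : RaisesWeight w N f := by
  obtain ⟨s, -, hs⟩ := hf
  intro m
  rw [← sub_add_cancel (f (Finsupp.single m 1)) (Finsupp.single (m + γ) (s m))]
  exact Submodule.add_mem _ (weightGE_anti (by omega) (hs m))
    (single_mem_weightGE (by rw [map_add]; omega) _)

theorem HasLead.mul {γ δ : Γ} {f g : Module.End K (Γ →₀ K)} (hf : HasLead w γ f)
    (hg : HasLead w δ g) : HasLead w (γ + δ) (f * g) := by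
  have hr := hf.raisesWeight le_rfl
  obtain ⟨s, hs0, hs⟩ := hf
  obtain ⟨t, ht0, ht⟩ := hg
  refine ⟨fun m => t m * s (m + δ), fun m => mul_ne_zero (ht0 m) (hs0 _), fun m => ?_⟩
  have h1 : Finsupp.single (m + δ) (t m) = t m • Finsupp.single (m + δ) (1 : K) := by simp
  have h2 : Finsupp.single (m + (γ + δ)) (t m * s (m + δ))
      = t m • Finsupp.single (m + δ + γ) (s (m + δ)) := by
    rw [Finsupp.smul_single, smul_eq_mul, add_assoc, add_comm δ γ]
  have h3 : (f * g) (Finsupp.single m 1) - Finsupp.single (m + (γ + δ)) (t m * s (m + δ))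
      = f (g (Finsupp.single m 1) - Finsupp.single (m + δ) (t m))
        + t m • (f (Finsupp.single (m + δ) 1)
          - Finsupp.single (m + δ + γ) (s (m + δ))) := by
    rw [h1, h2, Module.End.mul_apply, map_sub, map_smul, smul_sub]
    abel
  rw [h3]
  refine Submodule.add_mem _ (weightGE_anti ?_ (hr.map_mem (ht m)))
    (Submodule.smul_mem _ _ (weightGE_anti ?_ (hs (m + δ))))
  · rw [map_add]; omega
  · rw [map_add, map_add]; omega

theorem hasLead_one : HasLead w 0 (1 : Module.End K (Γ →₀ K)) :=
  ⟨fun _ => 1, fun _ => one_ne_zero, fun m => by simp⟩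

theorem HasLead.pow {γ : Γ} {f : Module.End K (Γ →₀ K)} (hf : HasLead w γ f) (k : ℕ) :
    HasLead w (k • γ) (f ^ k) := by
  induction k with
  | zero => simpa using hasLead_one
  | succ k ih =>
    rw [pow_succ, succ_nsmul]
    exact ih.mul hf

theorem HasLead.list_prod {α : Type*} (l : List α) {γ : α → Γ}
    {f : α → Module.End K (Γ →₀ K)} (h : ∀ a, HasLead w (γ a) (f a)) :
    HasLead w (l.map γ).sum (l.map f).prod := by
  induction l with
  | nil => simpa using hasLead_one
  | cons a l ih => simpa using (h a).mul ih

theorem HasLead.sum {α : Type*} [Fintype α] {γ : Γ} {f : α → Module.End K (Γ →₀ K)} (a₀ : α)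
    (h₀ : HasLead w γ (f a₀)) (h : ∀ a, a ≠ a₀ → RaisesWeight w (w γ + 1) (f a)) :
    HasLead w γ (∑ a, f a) := by
  classical
  obtain ⟨s, hs0, hs⟩ := h₀
  refine ⟨s, hs0, fun m => ?_⟩
  rw [← Finset.add_sum_erase _ _ (Finset.mem_univ a₀), LinearMap.add_apply, add_sub_right_comm,
    LinearMap.sum_apply]
  exact Submodule.add_mem _ (hs m)
    (Submodule.sum_mem _ fun a ha => h a (Finset.ne_of_mem_erase ha) m)

theorem linearIndependent_of_hasLead {α : Type*} {γ : α → Γ} (hγ : Function.Injective γ)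
    {f : α → Module.End K (Γ →₀ K)} (h : ∀ a, HasLead w (γ a) (f a)) :
    LinearIndependent K f := by
  classical
  refine LinearIndependent.of_comp (LinearMap.applyₗ (Finsupp.single 0 1)) ?_
  rw [linearIndependent_iff']
  intro t c hc a₁ ha₁
  by_contra hca₁
  obtain ⟨a₀, ha₀, hmin⟩ := (t.filter fun a => c a ≠ 0).exists_min_image (fun a => w (γ a))
    ⟨a₁, Finset.mem_filter.2 ⟨ha₁, hca₁⟩⟩
  obtain ⟨ha₀t, hca₀⟩ := Finset.mem_filter.1 ha₀
  choose s hs0 hs using h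
  have hval (a : α) (ha : w (γ a₀) ≤ w (γ a)) :
      f a (Finsupp.single 0 1) (γ a₀) = Finsupp.single (γ a) (s a 0) (γ a₀) := by
    have := hs a 0 (γ a₀) (by rw [map_zero]; omega)
    rwa [zero_add, Finsupp.sub_apply, sub_eq_zero] at this
  have heval := congrArg (fun v => v (γ a₀)) hc
  simp only [Function.comp_apply, LinearMap.applyₗ_apply_apply, Finsupp.finsetSum_apply,
    Finsupp.smul_apply, Finsupp.zero_apply, smul_eq_mul] at heval
  rw [Finset.sum_eq_single_of_mem a₀ ha₀t, hval a₀ le_rfl, Finsupp.single_eq_same] at heval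
  · exact (mul_ne_zero hca₀ (hs0 a₀ 0)) heval
  · intro a hat hne
    by_cases hca : c a = 0
    · rw [hca, zero_mul]
    · rw [hval a (hmin a (Finset.mem_filter.2 ⟨hat, hca⟩)),
        Finsupp.single_eq_of_ne (hγ.ne hne.symm), mul_zero]

/-- The operator shifting basis vectors by `γ` with coefficients `χ`. -/
def monomialOp (γ : Γ) (χ : Γ → K) : Module.End K (Γ →₀ K) :=
  Finsupp.linearCombination K fun m => Finsupp.single (m + γ) (χ m)

theorem monomialOp_single (γ : Γ) (χ : Γ → K) (m : Γ) :
    monomialOp γ χ (Finsupp.single m 1) = Finsupp.single (m + γ) (χ m) := by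
  simp [monomialOp]

theorem hasLead_monomialOp (γ : Γ) {χ : Γ → K} (hχ : ∀ m, χ m ≠ 0) :
    HasLead w γ (monomialOp γ χ) :=
  ⟨χ, hχ, fun m => by simp [monomialOp_single]⟩

theorem monomialOp_mul (γ δ : Γ) (χ ψ : Γ → K) :
    monomialOp γ χ * monomialOp δ ψ = monomialOp (γ + δ) fun m => ψ m * χ (m + δ) := by
  refine Finsupp.lhom_ext' fun m => LinearMap.ext_ring ?_
  have h : Finsupp.single (m + δ) (ψ m) = ψ m • Finsupp.single (m + δ) (1 : K) := by simp
  simp only [LinearMap.comp_apply, Finsupp.lsingle_apply, Module.End.mul_apply,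
    monomialOp_single]
  rw [h, map_smul, monomialOp_single, Finsupp.smul_single, smul_eq_mul, add_assoc,
    add_comm δ γ]

theorem smul_monomialOp (c : K) (γ : Γ) (χ : Γ → K) :
    c • monomialOp γ χ = monomialOp γ fun m => c * χ m := by
  refine Finsupp.lhom_ext' fun m => LinearMap.ext_ring ?_
  simp [monomialOp_single]

/-- The operator shifting basis vectors by `γ`. -/
def shiftOp (K : Type*) [Field K] (γ : Γ) : Module.End K (Γ →₀ K) := monomialOp γ fun _ => 1

/-- The diagonal operator scaling the basis vector `m` by `x ^ e m`. -/
def scaleOp (x : K) (e : Γ →+ ℤ) : Module.End K (Γ →₀ K) := monomialOp 0 fun m => x ^ e m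

theorem commute_shiftOp (γ δ : Γ) : Commute (shiftOp K γ) (shiftOp K δ) := by
  simp [Commute, SemiconjBy, shiftOp, monomialOp_mul, add_comm]

theorem commute_scaleOp (x : K) (e e' : Γ →+ ℤ) : Commute (scaleOp x e) (scaleOp x e') := by
  simp [Commute, SemiconjBy, scaleOp, monomialOp_mul, mul_comm]

theorem scaleOp_mul_shiftOp {x : K} (hx : x ≠ 0) (e : Γ →+ ℤ) (γ : Γ) :
    scaleOp x e * shiftOp K γ = x ^ e γ • (shiftOp K γ * scaleOp x e) := by
  simp [scaleOp, shiftOp, monomialOp_mul, smul_monomialOp, zpow_add₀ hx, mul_comm]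

theorem hasLead_shiftOp (γ : Γ) : HasLead w γ (shiftOp K γ) :=
  hasLead_monomialOp γ fun _ => one_ne_zero

theorem hasLead_scaleOp {x : K} (hx : x ≠ 0) (e : Γ →+ ℤ) : HasLead w 0 (scaleOp x e) :=
  hasLead_monomialOp 0 fun _ => zpow_ne_zero _ hx

end LeadingTerms

section Factorization

/-- The variables of the representation: `Sum.inl (b, r, u)` belongs to the position `(u, u - 1)`
of the `r`-th bidiagonal factor on the lower (`b = false`) or upper (`b = true`) side, and
`Sum.inr k` to the `k`-th entry of the diagonal factor. -/
abbrev PathVar : Type := (Bool × ℕ × ℕ) ⊕ ℕ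

/-- Exponents of monomials in the variables. -/
abbrev PathExp : Type := PathVar →₀ ℕ

/-- The algebra of operators on the space spanned by monomials. -/
abbrev PathOp : Type := Module.End Kq (PathExp →₀ Kq)

/-- The weight of a monomial. -/
def pathWeight : PathExp →+ ℕ :=
  Finsupp.weight (Sum.elim (fun x => x.2.1 + 1) fun _ => 0)

theorem pathWeight_single_inl (b : Bool) (r u : ℕ) :
    pathWeight (Finsupp.single (Sum.inl (b, r, u)) 1) = r + 1 := by
  simp [pathWeight, Finsupp.weight_single]

theorem pathWeight_single_inr (k : ℕ) :
    pathWeight (Finsupp.single (Sum.inr k) 1) = 0 := by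
  simp [pathWeight, Finsupp.weight_single]

/-- The exponent of a variable, as an integer. -/
def expHom (x : PathVar) : PathExp →+ ℤ :=
  (Nat.castAddMonoidHom ℤ).comp (Finsupp.applyAddHom x)

theorem expHom_single_self (x : PathVar) : expHom x (Finsupp.single x 1) = 1 := by
  simp [expHom]

theorem expHom_single_of_ne {x y : PathVar} (h : x ≠ y) :
    expHom x (Finsupp.single y 1) = 0 := by
  simp [expHom, Finsupp.single_eq_of_ne h]

/-- The diagonal entries of the bidiagonal factors. -/
def factorDiag (b : Bool) (r i : ℕ) : PathOp :=
  scaleOp (qq ^ 2) (expHom (Sum.inl (b, r, i + 1)) - expHom (Sum.inl (b, r, i)))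

/-- The off-diagonal entries of the bidiagonal factors. -/
def factorOff (b : Bool) (r i : ℕ) : PathOp :=
  shiftOp Kq (Finsupp.single (Sum.inl (b, r, i)) 1)

/-- The entries of the diagonal factor. -/
def diagVar (k : ℕ) : PathOp := shiftOp Kq (Finsupp.single (Sum.inr k) 1)

theorem qq_sq_ne_zero : qq ^ 2 ≠ 0 := pow_ne_zero 2 qq_ne_zero

theorem commute_factorDiag_shiftOp {b : Bool} {r i : ℕ} {x : PathVar}
    (h1 : Sum.inl (b, r, i + 1) ≠ x) (h2 : Sum.inl (b, r, i) ≠ x) :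
    Commute (factorDiag b r i) (shiftOp Kq (Finsupp.single x 1)) := by
  have := scaleOp_mul_shiftOp qq_sq_ne_zero
    (expHom (Sum.inl (b, r, i + 1)) - expHom (Sum.inl (b, r, i))) (Finsupp.single x 1)
  rwa [AddMonoidHom.sub_apply, expHom_single_of_ne h1, expHom_single_of_ne h2, sub_zero,
    zpow_zero, one_smul] at this

/-- The `r`-th bidiagonal factor. -/
def factor (n : ℕ) (b : Bool) (r : ℕ) : Matrix (Fin n) (Fin n) PathOp :=
  bidiagonal n (factorDiag b r) (factorOff b r)

theorem isQuantum_factor (n : ℕ) (b : Bool) (r : ℕ) : IsQuantum (factor n b r) := by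
  refine isQuantum_bidiagonal (fun i j => commute_scaleOp _ _ _) (fun i j => commute_shiftOp _ _)
    (fun i j h1 h2 => commute_factorDiag_shiftOp ?_ ?_) (fun i => ?_) (fun i => ?_)
  · simpa using h2.symm
  · simpa using h1.symm
  · have := scaleOp_mul_shiftOp qq_sq_ne_zero
      (expHom (Sum.inl (b, r, i + 1)) - expHom (Sum.inl (b, r, i)))
      (Finsupp.single (Sum.inl (b, r, i + 1)) 1)
    rwa [AddMonoidHom.sub_apply, expHom_single_self, expHom_single_of_ne (by simp), sub_zero,
      zpow_one] at this
  · have := scaleOp_mul_shiftOp qq_sq_ne_zero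
      (expHom (Sum.inl (b, r, i + 1)) - expHom (Sum.inl (b, r, i)))
      (Finsupp.single (Sum.inl (b, r, i)) 1)
    rw [AddMonoidHom.sub_apply, expHom_single_self, expHom_single_of_ne (by simp), zero_sub,
      zpow_neg_one] at this
    simp only [factorDiag, factorOff]
    rw [this, smul_inv_smul₀ qq_sq_ne_zero]

theorem commute_factor_shiftOp (n : ℕ) {b : Bool} {r : ℕ} {x : PathVar}
    (h : ∀ i, Sum.inl (b, r, i) ≠ x) (i j : Fin n) :
    Commute (factor n b r i j) (shiftOp Kq (Finsupp.single x 1)) := by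
  simp only [factor, bidiagonal]
  split_ifs
  · exact commute_factorDiag_shiftOp (h _) (h _)
  · exact commute_shiftOp _ _
  · exact Commute.zero_left _

theorem commute_factor (n : ℕ) {b b' : Bool} {r r' : ℕ} (h : (b, r) ≠ (b', r'))
    (i j k l : Fin n) : Commute (factor n b r i j) (factor n b' r' k l) := by
  have h1 : ∀ i k : ℕ, (Sum.inl (b, r, i) : PathVar) ≠ Sum.inl (b', r', k) := by
    rintro i k heq
    simp only [Sum.inl.injEq, Prod.mk.injEq] at heq
    exact h (Prod.ext heq.1 heq.2.1)
  rw [factor.eq_def n b']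
  simp only [bidiagonal]
  split_ifs
  · simp only [factor, bidiagonal]
    split_ifs
    · exact commute_scaleOp _ _ _
    · exact (commute_factorDiag_shiftOp (h1 _ _).symm (h1 _ _).symm).symm
    · exact Commute.zero_left _
  · exact commute_factor_shiftOp n (fun i => h1 i _) i j
  · exact Commute.zero_right _

/-- The product of the first `t` bidiagonal factors. -/
def factorProd (n : ℕ) (b : Bool) : ℕ → Matrix (Fin n) (Fin n) PathOp
  | 0 => 1
  | t + 1 => factorProd n b t * factor n b t

theorem commute_factorProd {n : ℕ} {b : Bool} {t : ℕ} {z : PathOp}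
    (h : ∀ r < t, ∀ k l, Commute z (factor n b r k l)) (i j : Fin n) :
    Commute z (factorProd n b t i j) := by
  induction t generalizing i j with
  | zero =>
    simp only [factorProd, Matrix.one_apply]
    split_ifs
    · exact Commute.one_right z
    · exact Commute.zero_right z
  | succ t ih =>
    rw [factorProd, Matrix.mul_apply]
    exact Commute.sum_right _ _ _ fun k _ =>
      (ih (fun r hr => h r (by omega)) i k).mul_right (h t (by omega) k j)

theorem isQuantum_factorProd (n : ℕ) (b : Bool) (t : ℕ) : IsQuantum (factorProd n b t) := by
  induction t with
  | zero =>
    rw [factorProd, ← Matrix.diagonal_one]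
    exact isQuantum_diagonal fun _ _ => Commute.one_left _
  | succ t ih =>
    refine ih.mul (isQuantum_factor n b t) fun i j k l => (commute_factorProd ?_ i j).symm
    intro r hr k' l'
    exact commute_factor n (by simp; omega) _ _ _ _

/-- The exponent of the leading term of the entry `(i, j)` of the product of bidiagonal factors. -/
def pathExp (b : Bool) (i j : ℕ) : PathExp :=
  ∑ u ∈ Finset.Ioc j i, Finsupp.single (Sum.inl (b, i - u, u)) 1

theorem pathExp_self (b : Bool) (i : ℕ) : pathExp b i i = 0 := by simp [pathExp]

theorem pathExp_step (b : Bool) {i j : ℕ} (h : j < i) :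
    pathExp b i j
      = pathExp b i (j + 1) + Finsupp.single (Sum.inl (b, i - (j + 1), j + 1)) 1 := by
  have : Finset.Ioc j i = insert (j + 1) (Finset.Ioc (j + 1) i) := by
    ext u
    simp only [Finset.mem_Ioc, Finset.mem_insert]
    omega
  rw [pathExp, this, Finset.sum_insert (by simp), add_comm, pathExp]

theorem pathWeight_pathExp_step (b : Bool) {i j : ℕ} (h : j < i) :
    pathWeight (pathExp b i j) = pathWeight (pathExp b i (j + 1)) + (i - (j + 1) + 1) := by
  rw [pathExp_step b h, map_add, pathWeight_single_inl]

theorem pathWeight_pathExp_lt (b : Bool) {i j k : ℕ} (hkj : k < j) (hji : j ≤ i) :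
    pathWeight (pathExp b i j) < pathWeight (pathExp b i k) := by
  induction j, hkj using Nat.le_induction with
  | base =>
    rw [pathWeight_pathExp_step b (by omega : k < i)]
    simp only [Nat.succ_eq_add_one]
    omega
  | succ j hj ih =>
    have := ih (by omega)
    rw [pathWeight_pathExp_step b (by omega : j < i)] at this
    omega

theorem hasLead_factorDiag (b : Bool) (r i : ℕ) : HasLead pathWeight 0 (factorDiag b r i) :=
  hasLead_scaleOp qq_sq_ne_zero _

theorem hasLead_factorOff (b : Bool) (r i : ℕ) :
    HasLead pathWeight (Finsupp.single (Sum.inl (b, r, i)) 1) (factorOff b r i) :=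
  hasLead_shiftOp _

theorem factorProd_eq_zero (n : ℕ) (b : Bool) (t : ℕ) {i j : Fin n}
    (h : (i : ℕ) < j ∨ (j : ℕ) + t < i) : factorProd n b t i j = 0 := by
  induction t generalizing i j with
  | zero => exact Matrix.one_apply_ne (by rintro rfl; omega)
  | succ t ih =>
    rw [factorProd, Matrix.mul_apply]
    refine Finset.sum_eq_zero fun k _ => ?_
    simp only [factor, bidiagonal]
    split_ifs with h1 h2
    · rw [ih (by omega), zero_mul]
    · rw [ih (by omega), zero_mul]
    · rw [mul_zero]

theorem hasLead_factorProd (n : ℕ) (b : Bool) (t : ℕ) {i j : Fin n} (hji : (j : ℕ) ≤ i)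
    (hij : (i : ℕ) ≤ j + t) : HasLead pathWeight (pathExp b i j) (factorProd n b t i j) := by
  induction t generalizing i j with
  | zero =>
    obtain rfl : i = j := Fin.ext (by omega)
    rw [factorProd, Matrix.one_apply_eq, pathExp_self]
    exact hasLead_one
  | succ t ih =>
    rw [factorProd, Matrix.mul_apply]
    rcases Nat.lt_or_ge (j + t) i with hlt | hge
    · have hj : (j : ℕ) + 1 < n := by omega
      have hoff : factor n b t ⟨j + 1, hj⟩ j = factorOff b t (j + 1) := by
        simp [factor, bidiagonal]
      have hlead := (ih (i := i) (j := ⟨j + 1, hj⟩) (by dsimp only; omega)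
        (by dsimp only; omega)).mul (hasLead_factorOff b t (j + 1))
      have hexp : pathExp b i j
          = pathExp b i (j + 1) + Finsupp.single (Sum.inl (b, t, (j : ℕ) + 1)) 1 := by
        rw [pathExp_step b (by omega), show (i : ℕ) - (j + 1) = t by omega]
      refine HasLead.sum ⟨j + 1, hj⟩ ?_ fun k hk => ?_
      · rw [hexp, hoff]
        exact hlead
      · have hk' : (k : ℕ) ≠ j + 1 := fun h => hk (Fin.ext h)
        have : factorProd n b t i k * factor n b t k j = 0 := by
          simp only [factor, bidiagonal]
          split_ifs with h1
          · rw [factorProd_eq_zero n b t (by omega), zero_mul]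
          · rw [mul_zero]
        rw [this]
        exact raisesWeight_zero _
    · refine HasLead.sum j ?_ fun k hk => ?_
      · have : factor n b t j j = factorDiag b t j := by simp [factor, bidiagonal]
        rw [this]
        simpa using (ih hji hge).mul (hasLead_factorDiag b t j)
      · have hk' : (k : ℕ) ≠ j := fun h => hk (Fin.ext h)
        simp only [factor, bidiagonal, hk', if_false]
        split_ifs with h1
        · rcases Nat.lt_or_ge i k with hik | hki
          · rw [factorProd_eq_zero n b t (Or.inl hik), zero_mul]
            exact raisesWeight_zero _
          · refine ((ih hki (by omega)).mul (hasLead_factorOff b t k)).raisesWeight ?_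
            rw [pathWeight_pathExp_step b (by omega : (j : ℕ) < i), map_add,
              pathWeight_single_inl, h1]
            omega
        · rw [mul_zero]
          exact raisesWeight_zero _

/-- The quantum matrix obtained as lower triangular times diagonal times upper triangular. -/
def pathMatrix (n : ℕ) : Matrix (Fin n) (Fin n) PathOp :=
  factorProd n false n * Matrix.diagonal (fun k : Fin n => diagVar k)
    * (factorProd n true n).transpose

theorem isQuantum_pathMatrix (n : ℕ) : IsQuantum (pathMatrix n) := by
  have hdiag (b : Bool) (k i j : Fin n) : Commute (diagVar k) (factorProd n b n i j) :=
    commute_factorProd (fun r _ i' j' =>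
      (commute_factor_shiftOp n (fun _ => Sum.inl_ne_inr) i' j').symm) i j
  refine ((isQuantum_factorProd n false n).mul (isQuantum_diagonal fun _ _ =>
    commute_shiftOp _ _) fun i j k l => ?_).mul (isQuantum_factorProd n true n).transpose
    fun i j k l => ?_
  · rw [Matrix.diagonal_apply]
    split_ifs
    · exact (hdiag _ _ _ _).symm
    · exact Commute.zero_right _
  · rw [Matrix.mul_diagonal, Matrix.transpose_apply]
    refine Commute.mul_left ?_ (hdiag _ _ _ _)
    refine commute_factorProd (fun r _ i' j' => (commute_factorProd (fun r' _ i'' j'' => ?_)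
      i j).symm) l k
    exact commute_factor n (by simp) _ _ _ _

/-- The exponent of the leading term of the entry `(i, j)` of `pathMatrix`. -/
def entryExp (i j : ℕ) : PathExp :=
  pathExp false i (min i j) + Finsupp.single (Sum.inr (min i j)) 1 + pathExp true j (min i j)

theorem hasLead_pathMatrix {n : ℕ} (i j : Fin n) :
    HasLead pathWeight (entryExp i j) (pathMatrix n i j) := by
  have hmin : ((min i j : Fin n) : ℕ) = min (i : ℕ) j := by
    rcases le_total i j with h | h
    · rw [min_eq_left h, min_eq_left (Fin.le_def.1 h)]
    · rw [min_eq_right h, min_eq_right (Fin.le_def.1 h)]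
  have hterm (k : Fin n) (hki : (k : ℕ) ≤ i) (hkj : (k : ℕ) ≤ j) : HasLead pathWeight
      (pathExp false i k + Finsupp.single (Sum.inr (k : ℕ)) 1 + pathExp true j k)
      (factorProd n false n i k * diagVar k * factorProd n true n j k) :=
    ((hasLead_factorProd n false n hki (by omega)).mul (hasLead_shiftOp _)).mul
      (hasLead_factorProd n true n hkj (by omega))
  rw [pathMatrix, Matrix.mul_apply]
  simp only [Matrix.mul_diagonal, Matrix.transpose_apply]
  refine HasLead.sum (min i j) ?_ fun k hk => ?_
  · rw [entryExp, ← hmin]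
    exact hterm _ (by omega) (by omega)
  · have hk' : (k : ℕ) ≠ min (i : ℕ) j := fun h => hk (Fin.ext (h.trans hmin.symm))
    rcases Nat.lt_or_ge i k with hik | hki
    · rw [factorProd_eq_zero n false n (Or.inl hik), zero_mul, zero_mul]
      exact raisesWeight_zero _
    rcases Nat.lt_or_ge j k with hjk | hkj
    · rw [factorProd_eq_zero n true n (Or.inl hjk), mul_zero]
      exact raisesWeight_zero _
    refine (hterm k hki hkj).raisesWeight ?_
    have h1 := pathWeight_pathExp_lt false (by omega : (k : ℕ) < min (i : ℕ) j)
      (min_le_left (i : ℕ) j)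
    have h2 := pathWeight_pathExp_lt true (by omega : (k : ℕ) < min (i : ℕ) j)
      (min_le_right (i : ℕ) j)
    simp only [entryExp, map_add, pathWeight_single_inr]
    omega

theorem pathExp_apply_inl (b b' : Bool) (i k r u : ℕ) :
    pathExp b i k (Sum.inl (b', r, u))
      = if b = b' ∧ k < u ∧ u ≤ i ∧ r = i - u then 1 else 0 := by
  classical
  simp only [pathExp, Finsupp.finsetSum_apply, Finsupp.single_apply, Sum.inl.injEq, Prod.mk.injEq]
  split_ifs with h
  · rw [Finset.sum_eq_single_of_mem u (Finset.mem_Ioc.2 ⟨h.2.1, h.2.2.1⟩)]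
    · simp [h.1, h.2.2.2]
    · intro v _ hv
      simp [hv]
  · refine Finset.sum_eq_zero fun v hv => if_neg ?_
    rintro ⟨h1, h2, rfl⟩
    rw [Finset.mem_Ioc] at hv
    exact h ⟨h1, hv.1, hv.2, h2.symm⟩

theorem pathExp_apply_inr (b : Bool) (i j k : ℕ) : pathExp b i j (Sum.inr k) = 0 := by
  classical
  simp [pathExp, Finsupp.finsetSum_apply]

theorem entryExp_apply_false {i j i₀ u : ℕ} (hui : u ≤ i₀) :
    entryExp i j (Sum.inl (false, i₀ - u, u)) = if i = i₀ ∧ j < u then 1 else 0 := by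
  simp only [entryExp, Finsupp.add_apply, pathExp_apply_inl]
  simp
  congr 1
  simp only [eq_iff_iff]
  omega

theorem entryExp_apply_true {i j j₀ u : ℕ} (huj : u ≤ j₀) :
    entryExp i j (Sum.inl (true, j₀ - u, u)) = if j = j₀ ∧ i < u then 1 else 0 := by
  simp only [entryExp, Finsupp.add_apply, pathExp_apply_inl]
  simp
  congr 1
  simp only [eq_iff_iff]
  omega

theorem entryExp_apply_inr (i j k : ℕ) :
    entryExp i j (Sum.inr k) = if min i j = k then 1 else 0 := by
  classical
  simp [entryExp, pathExp_apply_inr, Finsupp.single_apply]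

/-- The exponent of the leading term of the ordered monomial with exponent matrix `A`. -/
def monExp {n : ℕ} (A : Mat n) : PathExp := ∑ i : Fin n, ∑ j : Fin n, A i j • entryExp i j

theorem monExp_apply {n : ℕ} (A : Mat n) (x : PathVar) :
    monExp A x = ∑ i : Fin n, ∑ j : Fin n, A i j * entryExp i j x := by
  simp [monExp, Finsupp.finsetSum_apply]

theorem eq_of_sum_eq_of_forall_ne {α : Type*} [Fintype α] {f g : α → ℕ} (h : ∑ a, f a = ∑ a, g a)
    (a₀ : α) (hne : ∀ a, a ≠ a₀ → f a = g a) : f a₀ = g a₀ := by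
  classical
  rw [← Finset.add_sum_erase _ _ (Finset.mem_univ a₀), ← Finset.add_sum_erase _ g
    (Finset.mem_univ a₀), Finset.sum_congr rfl fun a ha => hne a (Finset.ne_of_mem_erase ha)] at h
  exact Nat.add_right_cancel h

theorem monExp_injective (n : ℕ) : Function.Injective (monExp (n := n)) := by
  intro A B hAB
  have happ (x : PathVar) : ∑ i : Fin n, ∑ j : Fin n, A i j * entryExp i j x
      = ∑ i : Fin n, ∑ j : Fin n, B i j * entryExp i j x := by
    rw [← monExp_apply, ← monExp_apply, hAB]
  have hlower : ∀ m : ℕ, ∀ i j : Fin n, (j : ℕ) = m → j < i → A i j = B i j := by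
    intro m
    induction m using Nat.strong_induction_on with
    | _ m ih =>
    intro i j hm hji
    have h := happ (Sum.inl (false, i - (j + 1), j + 1))
    simp only [entryExp_apply_false (Nat.succ_le_of_lt hji)] at h
    have h1 (C : Mat n) : ∑ i' : Fin n, ∑ j' : Fin n,
        C i' j' * (if (i' : ℕ) = i ∧ (j' : ℕ) < (j : ℕ).succ then 1 else 0)
        = ∑ j' : Fin n, if (j' : ℕ) < (j : ℕ).succ then C i j' else 0 := by
      rw [Finset.sum_eq_single i]
      · simp
      · intro i' _ hi'
        refine Finset.sum_eq_zero fun j' _ => ?_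
        rw [if_neg fun h => hi' (Fin.ext h.1), mul_zero]
      · simp
    rw [h1, h1] at h
    have := eq_of_sum_eq_of_forall_ne h j fun j' hj' => by
      split_ifs with hlt
      · have : (j' : ℕ) ≠ j := fun h => hj' (Fin.ext h)
        exact ih j' (by omega) i j' rfl (by omega)
      · rfl
    simpa using this
  have hupper : ∀ m : ℕ, ∀ i j : Fin n, (i : ℕ) = m → i < j → A i j = B i j := by
    intro m
    induction m using Nat.strong_induction_on with
    | _ m ih =>
    intro i j hm hij
    have h := happ (Sum.inl (true, j - (i + 1), i + 1))
    simp only [entryExp_apply_true (Nat.succ_le_of_lt hij)] at h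
    have h1 (C : Mat n) : ∑ i' : Fin n, ∑ j' : Fin n,
        C i' j' * (if (j' : ℕ) = j ∧ (i' : ℕ) < (i : ℕ).succ then 1 else 0)
        = ∑ i' : Fin n, if (i' : ℕ) < (i : ℕ).succ then C i' j else 0 := by
      refine Finset.sum_congr rfl fun i' _ => ?_
      rw [Finset.sum_eq_single j]
      · simp
      · intro j' _ hj'
        rw [if_neg fun h => hj' (Fin.ext h.1), mul_zero]
      · simp
    rw [h1, h1] at h
    have := eq_of_sum_eq_of_forall_ne h i fun i' hi' => by
      split_ifs with hlt
      · have : (i' : ℕ) ≠ i := fun h => hi' (Fin.ext h)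
        exact ih i' (by omega) i' j rfl (by omega)
      · rfl
    simpa using this
  ext i j
  rcases lt_trichotomy i j with h | rfl | h
  · exact hupper i i j rfl h
  · have h := happ (Sum.inr i)
    simp only [entryExp_apply_inr, ← Fintype.sum_prod_type'] at h
    have := eq_of_sum_eq_of_forall_ne h (i, i) fun p hp => by
      obtain ⟨k, l⟩ := p
      dsimp only
      rcases lt_trichotomy k l with hkl | rfl | hkl
      · rw [hupper k k l rfl hkl]
      · have : (k : ℕ) ≠ i := fun h => hp (by rw [Fin.ext h])
        simp [this]
      · rw [hlower l k l rfl hkl]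
    simpa using this
  · exact hlower j i j rfl h

theorem hasLead_orderedMon_pathMatrix {n : ℕ} (A : Mat n) :
    HasLead pathWeight (monExp A) (orderedMon (pathMatrix n) A) := by
  have h := HasLead.list_prod (List.finRange n) fun i =>
    HasLead.list_prod (List.finRange n) fun j => (hasLead_pathMatrix i j).pow (A i j)
  simp only [← Fin.sum_univ_def] at h
  exact h

theorem linearIndependent_xMon (n : ℕ) : LinearIndependent Kq (xMon n) := by
  refine LinearIndependent.of_comp (isQuantum_pathMatrix n).lift.toLinearMap ?_
  have : (isQuantum_pathMatrix n).lift.toLinearMap ∘ xMon n = orderedMon (pathMatrix n) := by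
    funext A
    simp [xMon, orderedMon, map_list_prod, Function.comp_def, IsQuantum.lift_xgen]
  rw [this]
  exact linearIndependent_of_hasLead (monExp_injective n) hasLead_orderedMon_pathMatrix

end Factorization

/-- The set `{x^A : A ∈ M_n(ℤ≥0)}` of lexicographically ordered monomials
is a basis of `O_q(M(n))` as a vector space over `K = ℚ(q)`. -/
theorem monomials_form_basis (n : ℕ) :
    LinearIndependent Kq (xMon n) ∧ Submodule.span Kq (Set.range (xMon n)) = ⊤ := by
  exact ⟨linearIndependent_xMon n, span_xMon n⟩
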